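/- arXiv:2311.00670 — 2 statements merged into one kernel-verified Lean document; each statement's English description precedes it below -/
import Mathlib

section
/- Sewing Lemma: Let E be a Banach space, T > 0, and let 0 < α ≤ 1 < β. Let A : Δ₂ → E satisfy A_{t,t} = 0 for all t and ‖A‖_{α,β} := ‖A‖_α + ‖δA‖_β < ∞. Then there exists a function 𝓘A : [0,T] → E with (𝓘A)_0 = 0 which is α-Hölder continuous, satisfies ‖(𝓘A)_t − (𝓘A)_s − A_{s,t}‖_E ≤ c ‖δA‖_β (t−s)^β for all (s,t) ∈ Δ₂ with a constant c > 0 depending only on β, and is such that for every (s,t) ∈ Δ₂ and every sequence of partitions of [s,t] whose mesh size tends to zero, the Riemann sums Σ_{[u,v] ∈ 𝒫} A_{u,v} converge to (𝓘A)_t − (𝓘A)_s. -/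
open Filter

theorem le_of_forall_step_le {p : ℕ → ℝ} {N : ℕ} (hp : ∀ i, i < N → p i ≤ p (i + 1))
    {i j : ℕ} (hij : i ≤ j) (hj : j ≤ N) : p i ≤ p j := by
  induction j, hij using Nat.le_induction with
  | base => exact le_rfl
  | succ j _ ih => exact (ih (by omega)).trans (hp j (by omega))

theorem exists_step_straddling {p : ℕ → ℝ} {N : ℕ} {m : ℝ} (hN : 0 < N) (h0 : p 0 ≤ m)
    (hm : m ≤ p N) : ∃ k < N, p k ≤ m ∧ m ≤ p (k + 1) := by
  induction N, hN using Nat.le_induction with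
  | base => exact ⟨0, one_pos, h0, hm⟩
  | succ N _ ih =>
    rcases le_total m (p N) with h | h
    · obtain ⟨k, hk, hk'⟩ := ih h
      exact ⟨k, by omega, hk'⟩
    · exact ⟨N, by omega, h, hm⟩

theorem sum_range_two_mul {E : Type*} [AddCommMonoid E] (f : ℕ → E) (n : ℕ) :
    ∑ i ∈ Finset.range (2 * n), f i = ∑ i ∈ Finset.range n, (f (2 * i) + f (2 * i + 1)) := by
  induction n with
  | zero => simp
  | succ n ih =>
    rw [Finset.sum_range_succ, ← ih, mul_add, mul_one, Finset.sum_range_succ,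
      Finset.sum_range_succ, add_assoc]

theorem two_mul_half_rpow_lt_one {β : ℝ} (hβ : 1 < β) : 2 * (1 / 2 : ℝ) ^ β < 1 := by
  have := Real.rpow_lt_rpow_of_exponent_gt (x := 1 / 2) (by norm_num) (by norm_num) hβ
  rw [Real.rpow_one] at this
  linarith

section Sewing

variable {E : Type*} [NormedAddCommGroup E] {A : ℝ → ℝ → E} {T β K : ℝ}

/-- Young's maximal inequality for Riemann sums of an almost additive germ. -/
theorem norm_riemannSum_sub_le (hβ : 1 < β) (hK : 0 ≤ K)
    (hA : ∀ t, 0 ≤ t → t ≤ T → A t t = 0)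
    (hδ : ∀ s u t, 0 ≤ s → s ≤ u → u ≤ t → t ≤ T → ‖A s t - A s u - A u t‖ ≤ K * (t - s) ^ β)
    (N : ℕ) (p : ℕ → ℝ) (hp : ∀ i, i < N → p i ≤ p (i + 1)) (h0 : 0 ≤ p 0) (hT : p N ≤ T) :
    ‖∑ i ∈ Finset.range N, A (p i) (p (i + 1)) - A (p 0) (p N)‖ ≤
      2 / (1 - 2 * (1 / 2 : ℝ) ^ β) * K * (p N - p 0) ^ β := by
  have hr := two_mul_half_rpow_lt_one hβ
  have hr0 : (0 : ℝ) < (1 / 2) ^ β := by positivity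
  set r : ℝ := (1 / 2) ^ β with hrdef
  set C : ℝ := 2 / (1 - 2 * r) with hC
  have hC0 : 0 ≤ C := div_nonneg (by norm_num) (by linarith)
  have hCr : 2 * C * r + 2 = C := by
    have : 1 - 2 * r ≠ 0 := by linarith
    rw [hC]
    field_simp
    ring
  induction N using Nat.strong_induction_on generalizing p with
  | _ N ih =>
    have hmono := fun {i j : ℕ} => le_of_forall_step_le (i := i) (j := j) hp
    have hL : p 0 ≤ p N := hmono (Nat.zero_le _) le_rfl
    rcases Nat.eq_zero_or_pos N with rfl | hN
    · simp only [Finset.range_zero, Finset.sum_empty, hA _ h0 hT, sub_zero, norm_zero]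
      positivity
    obtain ⟨k, hk, hk1, hk2⟩ :=
      exists_step_straddling (p := p) (m := (p 0 + p N) / 2) hN (by linarith) (by linarith)
    obtain ⟨l, rfl⟩ : ∃ l, N = k + 1 + l := ⟨N - (k + 1), by omega⟩
    have h0k := hmono (Nat.zero_le k) (by omega)
    have hkk := hp k hk
    have hkN := hmono (show k + 1 ≤ k + 1 + l by omega) le_rfl
    have e1 := ih k hk p (fun i hi => hp i (by omega)) h0 (by linarith)
    have e2 := ih l (by omega) (fun i => p (k + 1 + i)) (fun i hi => hp (k + 1 + i) (by omega))
      (by simp only [add_zero]; linarith) hT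
    have e3 := hδ (p 0) (p (k + 1)) (p (k + 1 + l)) h0 (by linarith) hkN hT
    have e4 := hδ (p 0) (p k) (p (k + 1)) h0 h0k hkk (by linarith)
    simp only [add_zero] at e2
    have half : ∀ x, 0 ≤ x → x ≤ (p (k + 1 + l) - p 0) / 2 →
        C * K * x ^ β ≤ C * K * ((p (k + 1 + l) - p 0) ^ β * r) := by
      intro x hx hx'
      rw [hrdef, ← Real.mul_rpow (by linarith) (by norm_num)]
      gcongr
      linarith
    have b1 := half (p k - p 0) (by linarith) (by linarith)
    have b2 := half (p (k + 1 + l) - p (k + 1)) (by linarith) (by linarith)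
    have b4 : K * (p (k + 1) - p 0) ^ β ≤ K * (p (k + 1 + l) - p 0) ^ β := by
      gcongr
      linarith
    rw [Finset.sum_range_add, Finset.sum_range_succ]
    set S₁ := ∑ i ∈ Finset.range k, A (p i) (p (i + 1))
    set S₂ := ∑ i ∈ Finset.range l, A (p (k + 1 + i)) (p (k + 1 + i + 1))
    have split : S₁ + A (p k) (p (k + 1)) + S₂ - A (p 0) (p (k + 1 + l)) =
        (S₁ - A (p 0) (p k)) + (S₂ - A (p (k + 1)) (p (k + 1 + l)))
        - (A (p 0) (p (k + 1 + l)) - A (p 0) (p (k + 1)) - A (p (k + 1)) (p (k + 1 + l)))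
        - (A (p 0) (p (k + 1)) - A (p 0) (p k) - A (p k) (p (k + 1))) := by abel
    have total : C * K * (p (k + 1 + l) - p 0) ^ β =
        2 * (C * K * ((p (k + 1 + l) - p 0) ^ β * r)) + 2 * (K * (p (k + 1 + l) - p 0) ^ β) := by
      nth_rewrite 1 [← hCr]
      ring
    rw [split, total]
    refine (norm_sub_le _ _).trans ?_
    have n1 := norm_sub_le
      ((S₁ - A (p 0) (p k)) + (S₂ - A (p (k + 1)) (p (k + 1 + l))))
      (A (p 0) (p (k + 1 + l)) - A (p 0) (p (k + 1)) - A (p (k + 1)) (p (k + 1 + l)))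
    have n2 := norm_add_le (S₁ - A (p 0) (p k)) (S₂ - A (p (k + 1)) (p (k + 1 + l)))
    have e2' : ‖S₂ - A (p (k + 1)) (p (k + 1 + l))‖ ≤
      C * K * (p (k + 1 + l) - p (k + 1)) ^ β := e2
    linarith

/-- The Riemann sum of `A` over the `n`-th dyadic partition of `[0, T]`, clamped to `[s, t]`. -/
noncomputable def dyadicSum (A : ℝ → ℝ → E) (T s t : ℝ) (n : ℕ) : E :=
  ∑ i ∈ Finset.range (2 ^ n), A (max s (min (i * (T / 2 ^ n)) t))
    (max s (min ((i + 1 : ℕ) * (T / 2 ^ n)) t))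

theorem two_pow_mul_rpow_div (hT : 0 ≤ T) (n : ℕ) :
    (2 : ℝ) ^ n * (K * (T / 2 ^ n) ^ β) = K * T ^ β * (2 * (1 / 2 : ℝ) ^ β) ^ n := by
  rw [div_eq_mul_one_div, ← one_div_pow, Real.mul_rpow hT (by positivity),
    ← Real.rpow_pow_comm (by norm_num), mul_pow]
  ring

theorem norm_dyadicSum_sub_le (hT : 0 < T) (hβ : 1 < β) (hK : 0 ≤ K)
    (hA : ∀ t, 0 ≤ t → t ≤ T → A t t = 0)
    (hδ : ∀ s u t, 0 ≤ s → s ≤ u → u ≤ t → t ≤ T → ‖A s t - A s u - A u t‖ ≤ K * (t - s) ^ β)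
    {s t : ℝ} (hs : 0 ≤ s) (hst : s ≤ t) (htT : t ≤ T) (n : ℕ) :
    ‖dyadicSum A T s t n - A s t‖ ≤ 2 / (1 - 2 * (1 / 2 : ℝ) ^ β) * K * (t - s) ^ β := by
  have h0 : max s (min (((0 : ℕ) : ℝ) * (T / 2 ^ n)) t) = s := by
    simp [hs, hs.trans hst]
  have h1 : max s (min (((2 ^ n : ℕ) : ℝ) * (T / 2 ^ n)) t) = t := by
    have : ((2 ^ n : ℕ) : ℝ) * (T / 2 ^ n) = T := by
      push_cast
      field_simp
    rw [this, min_eq_right htT, max_eq_right hst]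
  have := norm_riemannSum_sub_le hβ hK hA hδ (2 ^ n)
    (fun i => max s (min ((i : ℝ) * (T / 2 ^ n)) t)) (fun i _ => by gcongr; simp)
    (hs.trans (le_max_left _ _)) (h1.le.trans htT)
  rw [h0, h1] at this
  exact this

theorem dist_dyadicSum_succ_le (hT : 0 < T) (hβ : 1 < β) (hK : 0 ≤ K)
    (hδ : ∀ s u t, 0 ≤ s → s ≤ u → u ≤ t → t ≤ T → ‖A s t - A s u - A u t‖ ≤ K * (t - s) ^ β)
    {s t : ℝ} (hs : 0 ≤ s) (hst : s ≤ t) (htT : t ≤ T) (n : ℕ) :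
    dist (dyadicSum A T s t n) (dyadicSum A T s t (n + 1)) ≤
      K * T ^ β * (2 * (1 / 2 : ℝ) ^ β) ^ n := by
  have e1 : ∀ i : ℕ, ((2 * i : ℕ) : ℝ) * (T / 2 ^ (n + 1)) = i * (T / 2 ^ n) := fun i => by
    push_cast
    field_simp
    ring
  have e2 : ∀ i : ℕ, ((2 * i + 1 + 1 : ℕ) : ℝ) * (T / 2 ^ (n + 1)) = (i + 1 : ℕ) * (T / 2 ^ n) :=
    fun i => by rw [← e1]; rfl
  rw [dist_eq_norm, ← two_pow_mul_rpow_div hT.le]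
  unfold dyadicSum
  rw [pow_succ' 2 n, sum_range_two_mul, ← Finset.sum_sub_distrib]
  refine (norm_sum_le_of_le (f := _) _ (n := fun _ => K * (T / 2 ^ n) ^ β) ?_).trans (by simp)
  intro i _
  rw [e1, e2, ← sub_sub]
  have hh : ((i + 1 : ℕ) : ℝ) * (T / 2 ^ n) = i * (T / 2 ^ n) + T / 2 ^ n := by push_cast; ring
  have := hδ (max s (min ((i : ℝ) * (T / 2 ^ n)) t))
    (max s (min (((2 * i + 1 : ℕ) : ℝ) * (T / 2 ^ (n + 1))) t))
    (max s (min (((i + 1 : ℕ) : ℝ) * (T / 2 ^ n)) t)) (hs.trans (le_max_left _ _))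
    (by rw [← e1]; gcongr; simp) (by rw [← e2]; gcongr; simp)
    (max_le (hst.trans htT) ((min_le_right _ _).trans htT))
  refine this.trans ?_
  have hTn : 0 ≤ T / 2 ^ n := by positivity
  gcongr
  · rw [sub_nonneg]; gcongr; simp
  · rw [hh]
    generalize (i : ℝ) * (T / 2 ^ n) = x
    rw [sub_le_iff_le_add]
    refine max_le (by linarith [le_max_left s (min x t)]) ?_
    refine le_trans ?_ (add_le_add_right (le_max_right s (min x t)) _)
    rw [← min_add_add_left]
    exact min_le_min (by linarith) (by linarith)

theorem norm_dyadicSum_add_sub_le (hT : 0 < T) (hβ : 1 < β) (hK : 0 ≤ K)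
    (hA : ∀ t, 0 ≤ t → t ≤ T → A t t = 0)
    (hδ : ∀ s u t, 0 ≤ s → s ≤ u → u ≤ t → t ≤ T → ‖A s t - A s u - A u t‖ ≤ K * (t - s) ^ β)
    {s t : ℝ} (hs : 0 ≤ s) (hst : s ≤ t) (htT : t ≤ T) (n : ℕ) :
    ‖dyadicSum A T 0 t n - dyadicSum A T 0 s n - dyadicSum A T s t n‖ ≤
      K * T ^ β * (2 * (1 / 2 : ℝ) ^ β) ^ n := by
  rw [← two_pow_mul_rpow_div hT.le]
  unfold dyadicSum
  rw [← Finset.sum_sub_distrib, ← Finset.sum_sub_distrib]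
  refine (norm_sum_le_of_le (f := _) _ (n := fun _ => K * (T / 2 ^ n) ^ β) ?_).trans (by simp)
  intro i _
  have hh : ((i + 1 : ℕ) : ℝ) * (T / 2 ^ n) = i * (T / 2 ^ n) + T / 2 ^ n := by push_cast; ring
  have hTn : 0 ≤ T / 2 ^ n := by positivity
  have hx : 0 ≤ (i : ℝ) * (T / 2 ^ n) := by positivity
  have hR : 0 ≤ K * (T / 2 ^ n) ^ β := by positivity
  have ht := hs.trans hst
  have hsT := hst.trans htT
  rw [hh]
  generalize (i : ℝ) * (T / 2 ^ n) = x at *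
  generalize T / 2 ^ n = h at *
  rw [max_eq_right (le_min hx ht), max_eq_right (le_min (add_nonneg hx hTn) ht),
    max_eq_right (le_min hx hs), max_eq_right (le_min (add_nonneg hx hTn) hs)]
  rcases le_total (x + h) s with h1 | h1
  · have h2 : x ≤ s := by linarith
    rw [min_eq_left (h2.trans hst), min_eq_left (h1.trans hst), min_eq_left h1, min_eq_left h2,
      max_eq_left h1, max_eq_left h2, hA s hs hsT]
    simpa using hR
  rcases le_total s x with h2 | h2
  · rw [min_eq_right h2, min_eq_right h1, max_eq_right (le_min h2 hst),
      max_eq_right (le_min h1 hst), hA s hs hsT]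
    simpa using hR
  · rw [min_eq_left (h2.trans hst), min_eq_left h2, min_eq_right h1, max_eq_left h2,
      max_eq_right (le_min h1 hst)]
    refine (hδ x s (min (x + h) t) hx h2 (le_min h1 hst) ((min_le_right _ _).trans htT)).trans ?_
    gcongr
    · linarith [le_min h1 hst]
    · linarith [min_le_left (x + h) t]

theorem exists_norm_increment_sub_le [CompleteSpace E] (hT : 0 < T) (hβ : 1 < β) (hK : 0 ≤ K)
    (hA : ∀ t, 0 ≤ t → t ≤ T → A t t = 0)
    (hδ : ∀ s u t, 0 ≤ s → s ≤ u → u ≤ t → t ≤ T → ‖A s t - A s u - A u t‖ ≤ K * (t - s) ^ β) :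
    ∃ I : ℝ → E, I 0 = 0 ∧ ∀ s t, 0 ≤ s → s ≤ t → t ≤ T →
      ‖I t - I s - A s t‖ ≤ 2 / (1 - 2 * (1 / 2 : ℝ) ^ β) * K * (t - s) ^ β := by
  have hr := two_mul_half_rpow_lt_one hβ
  have hlim : ∀ t, 0 ≤ t → t ≤ T → Tendsto (dyadicSum A T 0 t) atTop
      (nhds (limUnder atTop (dyadicSum A T 0 t))) := fun t h0 h1 =>
    (cauchySeq_of_le_geometric _ _ hr
      (dist_dyadicSum_succ_le hT hβ hK hδ le_rfl h0 h1)).tendsto_limUnder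
  refine ⟨fun t => limUnder atTop (dyadicSum A T 0 t), ?_, fun s t hs hst htT => ?_⟩
  · refine tendsto_nhds_unique (hlim 0 le_rfl hT.le) (tendsto_const_nhds.congr fun n => ?_)
    simp [dyadicSum, hA 0 le_rfl hT.le]
  · have hdiff : Tendsto (fun n => dyadicSum A T 0 t n - dyadicSum A T 0 s n
        - dyadicSum A T s t n) atTop (nhds 0) := by
      refine squeeze_zero_norm (norm_dyadicSum_add_sub_le hT hβ hK hA hδ hs hst htT) ?_
      simpa using (tendsto_pow_atTop_nhds_zero_of_lt_one (by positivity) hr).const_mul (K * T ^ β)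
    have h1 := ((hlim t (hs.trans hst) htT).sub (hlim s hs (hst.trans htT))).sub hdiff
    refine le_of_tendsto ((h1.sub_const (A s t)).norm.congr fun n => ?_ :
      Tendsto (fun n => ‖dyadicSum A T s t n - A s t‖) atTop _) ?_ |>.trans' ?_
    · rw [sub_sub_cancel]
    · exact Eventually.of_forall (norm_dyadicSum_sub_le hT hβ hK hA hδ hs hst htT)
    · simp

theorem tendsto_riemannSum {I : ℝ → E} (hβ : 1 < β) (hK : 0 ≤ K)
    (hI : ∀ s t, 0 ≤ s → s ≤ t → t ≤ T → ‖I t - I s - A s t‖ ≤ K * (t - s) ^ β)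
    {s t : ℝ} (hs : 0 ≤ s) (htT : t ≤ T) {N : ℕ → ℕ} {p : ℕ → ℕ → ℝ} {mesh : ℕ → ℝ}
    (hp0 : ∀ n, p n 0 = s) (hpN : ∀ n, p n (N n) = t)
    (hp : ∀ n i, i < N n → p n i ≤ p n (i + 1))
    (hmesh : ∀ n i, i < N n → p n (i + 1) - p n i ≤ mesh n) (hlim : Tendsto mesh atTop (nhds 0)) :
    Tendsto (fun n => ∑ i ∈ Finset.range (N n), A (p n i) (p n (i + 1)))
      atTop (nhds (I t - I s)) := by
  rw [tendsto_iff_norm_sub_tendsto_zero]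
  have hbound : Tendsto (fun n => K * |mesh n| ^ (β - 1) * (t - s)) atTop (nhds 0) := by
    have h := hlim.abs.rpow_const (p := β - 1) (Or.inr (by linarith))
    rw [abs_zero, Real.zero_rpow (by linarith)] at h
    simpa using (h.const_mul K).mul_const (t - s)
  refine squeeze_zero (fun _ => norm_nonneg _) (fun n => ?_) hbound
  have telI : I t - I s = ∑ i ∈ Finset.range (N n), (I (p n (i + 1)) - I (p n i)) := by
    rw [Finset.sum_range_sub (fun i => I (p n i)), hp0, hpN]
  have telp : t - s = ∑ i ∈ Finset.range (N n), (p n (i + 1) - p n i) := by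
    rw [Finset.sum_range_sub (fun i => p n i), hp0, hpN]
  rw [norm_sub_rev, telI, telp, ← Finset.sum_sub_distrib, Finset.mul_sum]
  refine norm_sum_le_of_le _ fun i hi => ?_
  rw [Finset.mem_range] at hi
  have h0 : 0 ≤ p n i := hs.trans <| (hp0 n).ge.trans <|
    le_of_forall_step_le (hp n) (Nat.zero_le i) hi.le
  have h1 : p n (i + 1) ≤ T := (le_of_forall_step_le (hp n) hi le_rfl).trans
    ((hpN n).le.trans htT)
  have hd : 0 ≤ p n (i + 1) - p n i := sub_nonneg.2 (hp n i hi)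
  refine (hI _ _ h0 (hp n i hi) h1).trans ?_
  rw [mul_assoc]
  calc K * (p n (i + 1) - p n i) ^ β
      = K * ((p n (i + 1) - p n i) ^ (β - 1) * (p n (i + 1) - p n i)) := by
        rw [← Real.rpow_add_one' hd (by linarith), sub_add_cancel]
    _ ≤ K * (|mesh n| ^ (β - 1) * (p n (i + 1) - p n i)) := by
        gcongr
        exact (hmesh n i hi).trans (le_abs_self _)

end Sewing

/-- **Sewing Lemma.** Let `E` be a Banach space, `T > 0` and `0 < α ≤ 1 < β`.  For any germ
`A : Δ₂ → E` vanishing on the diagonal with finite `‖A‖_α` and `‖δA‖_β` (witnessed by bounds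
`Ka` and `Kδ`), there is a function `I : [0,T] → E` with `I 0 = 0`, which is `α`-Hölder
continuous, satisfies `‖I t − I s − A s t‖ ≤ c ‖δA‖_β (t−s)^β` with a constant `c > 0`
depending only on `β`, and whose increments are the limits of Riemann sums of `A` along any
sequence of partitions with vanishing mesh size. -/
theorem sewing_lemma (α β : ℝ) (hα0 : 0 < α) (hα1 : α ≤ 1) (hβ : 1 < β) :
    ∃ c : ℝ, 0 < c ∧
      ∀ (E : Type) [NormedAddCommGroup E] [NormedSpace ℝ E] [CompleteSpace E]
        (T : ℝ), 0 < T →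
        ∀ (A : ℝ → ℝ → E) (Ka Kδ : ℝ),
        (∀ t, 0 ≤ t → t ≤ T → A t t = 0) →
        (∀ s t, 0 ≤ s → s ≤ t → t ≤ T → ‖A s t‖ ≤ Ka * (t - s) ^ α) →
        (∀ s u t, 0 ≤ s → s ≤ u → u ≤ t → t ≤ T →
          ‖A s t - A s u - A u t‖ ≤ Kδ * (t - s) ^ β) →
        ∃ I : ℝ → E,
          I 0 = 0 ∧
          (∃ K : ℝ, ∀ s t, 0 ≤ s → s ≤ t → t ≤ T → ‖I t - I s‖ ≤ K * (t - s) ^ α) ∧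
          (∀ s t, 0 ≤ s → s ≤ t → t ≤ T →
            ‖I t - I s - A s t‖ ≤ c * Kδ * (t - s) ^ β) ∧
          (∀ s t, 0 ≤ s → s ≤ t → t ≤ T →
            ∀ (N : ℕ → ℕ) (p : ℕ → ℕ → ℝ) (mesh : ℕ → ℝ),
              (∀ n, p n 0 = s) → (∀ n, p n (N n) = t) →
              (∀ n i, i < N n → p n i ≤ p n (i + 1)) →
              (∀ n i, i < N n → p n (i + 1) - p n i ≤ mesh n) →
              Tendsto mesh atTop (nhds 0) →
              Tendsto (fun n => ∑ i ∈ Finset.range (N n), A (p n i) (p n (i + 1)))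
                atTop (nhds (I t - I s))) := by
  refine ⟨2 / (1 - 2 * (1 / 2 : ℝ) ^ β),
    div_pos two_pos (by linarith [two_mul_half_rpow_lt_one hβ]), fun E _ _ _ T hT A Ka Kδ hA hα hδ => ?_⟩
  have hK : 0 ≤ Kδ := by
    have := (norm_nonneg _).trans (hδ 0 0 T le_rfl le_rfl hT.le le_rfl)
    exact nonneg_of_mul_nonneg_left this (by rw [sub_zero]; positivity)
  obtain ⟨I, hI0, hI⟩ := exists_norm_increment_sub_le hT hβ hK hA hδ
  have hC : 0 ≤ 2 / (1 - 2 * (1 / 2 : ℝ) ^ β) * Kδ :=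
    mul_nonneg (div_nonneg two_pos.le (by linarith [two_mul_half_rpow_lt_one hβ])) hK
  refine ⟨I, hI0, ⟨2 / (1 - 2 * (1 / 2 : ℝ) ^ β) * Kδ * T ^ (β - α) + Ka,
    fun s t hs hst htT => ?_⟩, hI, fun s t hs _ htT N p mesh h0 hN hp hm hlim =>
    tendsto_riemannSum hβ hC hI hs htT h0 hN hp hm hlim⟩
  have hd : 0 ≤ t - s := sub_nonneg.2 hst
  have hpow : (t - s) ^ β ≤ T ^ (β - α) * (t - s) ^ α := by
    calc (t - s) ^ β = (t - s) ^ (β - α) * (t - s) ^ α := by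
          rw [← Real.rpow_add_of_nonneg hd (by linarith) hα0.le, sub_add_cancel]
      _ ≤ T ^ (β - α) * (t - s) ^ α := by
          gcongr
          · linarith
          · linarith
  calc ‖I t - I s‖ ≤ ‖I t - I s - A s t‖ + ‖A s t‖ := norm_le_norm_sub_add _ _
    _ ≤ 2 / (1 - 2 * (1 / 2 : ℝ) ^ β) * Kδ * (T ^ (β - α) * (t - s) ^ α) + Ka * (t - s) ^ α :=
        add_le_add ((hI s t hs hst htT).trans (mul_le_mul_of_nonneg_left hpow hC))
          (hα s t hs hst htT)
    _ = _ := by ring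
end

section
/- Quantified L^∞ bound for degree-zero homogeneous Fourier multipliers on frequency-localized mean-free functions: let m ∈ C^∞(ℝ² ∖ {0}) be homogeneous of degree 0 and let T_m be the Fourier multiplier on functions on the two-dimensional torus defined by (T_m a)^(k) = m(k) â(k) for k ≠ 0. Then there exists a constant C_m ≥ 1 such that for every μ ≥ 10 and every mean-free trigonometric polynomial a(x) = Σ_{0 < |k| ≤ μ} â(k) e^{i k·x} on 𝕋², one has ‖T_m a‖_{L^∞(𝕋²)} ≤ C_m log(μ) ‖a‖_{L^∞(𝕋²)}. -/
/-- Euclidean norm of a frequency `k ∈ ℤ²`. -/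
noncomputable def znorm (k : ℤ × ℤ) : ℝ := Real.sqrt ((k.1 : ℝ) ^ 2 + (k.2 : ℝ) ^ 2)

/-- The trigonometric polynomial on the torus with Fourier coefficients `ahat`, viewed as a
periodic function on `ℝ²`: `x ↦ Σ_k ahat(k) e^{i k·x}`. -/
noncomputable def trigPoly (ahat : ℤ × ℤ → ℂ) (x : ℝ × ℝ) : ℂ :=
  ∑' k : ℤ × ℤ, ahat k * Complex.exp (Complex.I * (((k.1 : ℝ) * x.1 + (k.2 : ℝ) * x.2 : ℝ) : ℂ))

open MeasureTheory FourierTransform in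
/-- A smooth compactly supported symbol, dilated by any factor, defines a multiplier on
exponential sums which is bounded in the sup norm, uniformly in the dilation. -/
theorem exists_uniform_bound_of_hasCompactSupport
    {V : Type*} [NormedAddCommGroup V] [InnerProductSpace ℝ V] [FiniteDimensional ℝ V]
    [MeasurableSpace V] [BorelSpace V] {f : V → ℂ}
    (hf : ContDiff ℝ (⊤ : ℕ∞) f) (hsupp : HasCompactSupport f) :
    ∃ C : ℝ, 0 ≤ C ∧ ∀ {ι : Type} (s : Finset ι) (v : ι → V) (c : ι → ℂ) (t B : ℝ),
      (∀ x : V, ‖∑ k ∈ s, c k * Complex.exp (Complex.I * (inner ℝ (v k) x : ℝ))‖ ≤ B) →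
      ∀ x : V, ‖∑ k ∈ s, f (t • v k) * c k *
        Complex.exp (Complex.I * (inner ℝ (v k) x : ℝ))‖ ≤ C * B := by
  set F : SchwartzMap V ℂ := 𝓕 (hsupp.toSchwartzMap hf) 
  have hinv (ξ : V) : f ξ =
      ∫ y, Complex.exp ((2 * Real.pi * inner ℝ y ξ : ℝ) * Complex.I) * F y := by
    have h : 𝓕⁻ F = hsupp.toSchwartzMap hf := FourierTransform.fourierInv_fourier_eq _
    calc f ξ = (𝓕⁻ F) ξ := by rw [h]; rfl
      _ = _ := by rw [SchwartzMap.fourierInv_coe, Real.fourierInv_eq']; rfl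
  have hint (ξ : V) : Integrable
      (fun y => Complex.exp ((2 * Real.pi * inner ℝ y ξ : ℝ) * Complex.I) * F y) := by
    refine F.integrable.bdd_mul (c := 1) ?_ (.of_forall fun y => ?_)
    · exact Continuous.aestronglyMeasurable (by fun_prop)
    · rw [Complex.norm_exp_ofReal_mul_I]
  refine ⟨∫ y, ‖F y‖, integral_nonneg fun _ => norm_nonneg _, fun {ι} s v c t B hB x => ?_⟩
  have key : ∑ k ∈ s, f (t • v k) * c k * Complex.exp (Complex.I * (inner ℝ (v k) x : ℝ)) =
      ∫ y, F y * ∑ k ∈ s, c k *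
        Complex.exp (Complex.I * (inner ℝ (v k) (x + (2 * Real.pi * t) • y) : ℝ)) := by
    have h (k : ι) : f (t • v k) * c k * Complex.exp (Complex.I * (inner ℝ (v k) x : ℝ)) =
        ∫ y, Complex.exp ((2 * Real.pi * inner ℝ y (t • v k) : ℝ) * Complex.I) * F y *
          (c k * Complex.exp (Complex.I * (inner ℝ (v k) x : ℝ))) := by
      rw [integral_mul_const, ← hinv, mul_assoc]
    simp_rw [h]
    rw [← integral_finsetSum _ fun k _ => (hint _).mul_const _]
    refine integral_congr_ae (.of_forall fun y => ?_)
    simp only [Finset.mul_sum]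
    refine Finset.sum_congr rfl fun k _ => ?_
    rw [inner_add_right, inner_smul_right, inner_smul_right, real_inner_comm]
    push_cast
    rw [mul_add, Complex.exp_add]
    ring_nf
  rw [key, ← integral_mul_const]
  refine norm_integral_le_of_norm_le (F.integrable.norm.mul_const B) (.of_forall fun y => ?_)
  rw [norm_mul]
  exact mul_le_mul_of_nonneg_left (hB _) (norm_nonneg _)

open Metric in
/-- A function that is smooth away from the origin becomes smooth when multiplied by an
annular difference of dilated bump functions. -/
theorem ContDiffBump.contDiff_sub_dilate_mul
    {V : Type*} [NormedAddCommGroup V] [InnerProductSpace ℝ V] [FiniteDimensional ℝ V]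
    (χ : ContDiffBump (0 : V)) {g : V → ℂ} (hg : ∀ ξ ≠ 0, ContDiffAt ℝ (⊤ : ℕ∞) g ξ) :
    ContDiff ℝ (⊤ : ℕ∞) fun ξ => g ξ * ((χ ξ - χ ((2 : ℝ) • ξ) : ℝ) : ℂ) := by
  have hχ : ContDiff ℝ (⊤ : ℕ∞) fun ξ => ((χ ξ - χ ((2 : ℝ) • ξ) : ℝ) : ℂ) :=
    Complex.ofRealCLM.contDiff.comp
      (χ.contDiff.sub (χ.contDiff.comp (contDiff_const_smul (2 : ℝ))))
  refine contDiff_iff_contDiffAt.2 fun ξ => ?_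
  rcases eq_or_ne ξ 0 with rfl | hξ
  · refine (contDiffAt_const (c := (0 : ℂ))).congr_of_eventuallyEq ?_
    filter_upwards [ball_mem_nhds (0 : V) (half_pos χ.rIn_pos)] with ξ hξ
    rw [mem_ball_zero_iff] at hξ
    rw [χ.one_of_mem_closedBall, χ.one_of_mem_closedBall]
    · simp
    · rw [mem_closedBall_zero_iff, norm_smul, Real.norm_eq_abs, abs_two]; linarith
    · rw [mem_closedBall_zero_iff]; linarith [χ.rIn_pos]
  · exact (hg ξ hξ).mul hχ.contDiffAt

/-- A frequency as a vector of the Euclidean plane. -/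
noncomputable def freqVec (k : ℤ × ℤ) : EuclideanSpace ℝ (Fin 2) := !₂[(k.1 : ℝ), (k.2 : ℝ)]

theorem norm_freqVec (k : ℤ × ℤ) : ‖freqVec k‖ = znorm k := by
  simp [freqVec, znorm, EuclideanSpace.norm_eq]

theorem one_le_znorm {k : ℤ × ℤ} (hk : k ≠ 0) : 1 ≤ znorm k := by
  rw [znorm, Real.one_le_sqrt]
  have h : 1 ≤ k.1 ^ 2 + k.2 ^ 2 := by
    by_contra! h
    have h1 : k.1 = 0 := by nlinarith [sq_nonneg k.1, sq_nonneg k.2]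
    have h2 : k.2 = 0 := by nlinarith [sq_nonneg k.1, sq_nonneg k.2]
    exact hk (Prod.ext h1 h2)
  exact_mod_cast h

theorem finite_setOf_znorm_le (μ : ℝ) : {k : ℤ × ℤ | znorm k ≤ μ}.Finite := by
  refine (Set.finite_Icc ((-⌈μ⌉, -⌈μ⌉) : ℤ × ℤ) (⌈μ⌉, ⌈μ⌉)).subset fun k hk => ?_
  have h1 : |(k.1 : ℝ)| ≤ ⌈μ⌉ :=
    (Real.abs_le_sqrt (by nlinarith [sq_nonneg (k.2 : ℝ)])).trans (hk.trans (Int.le_ceil μ))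
  have h2 : |(k.2 : ℝ)| ≤ ⌈μ⌉ :=
    (Real.abs_le_sqrt (by nlinarith [sq_nonneg (k.1 : ℝ)])).trans (hk.trans (Int.le_ceil μ))
  rw [abs_le] at h1 h2
  exact ⟨⟨by exact_mod_cast h1.1, by exact_mod_cast h2.1⟩,
    ⟨by exact_mod_cast h1.2, by exact_mod_cast h2.2⟩⟩

theorem trigPoly_eq_sum {ahat : ℤ × ℤ → ℂ} {s : Finset (ℤ × ℤ)} (hs : ∀ k ∉ s, ahat k = 0)
    (x : EuclideanSpace ℝ (Fin 2)) :
    trigPoly ahat (x 0, x 1) =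
      ∑ k ∈ s, ahat k * Complex.exp (Complex.I * (inner ℝ (freqVec k) x : ℝ)) := by
  rw [trigPoly, tsum_eq_sum (s := s) fun k hk => by simp [hs k hk]]
  refine Finset.sum_congr rfl fun k _ => ?_
  simp [freqVec, PiLp.inner_apply, Fin.sum_univ_two, mul_comm]

theorem bddAbove_range_norm_trigPoly {ahat : ℤ × ℤ → ℂ} {s : Finset (ℤ × ℤ)}
    (hs : ∀ k ∉ s, ahat k = 0) : BddAbove (Set.range fun x => ‖trigPoly ahat x‖) := by
  refine ⟨∑ k ∈ s, ‖ahat k‖, ?_⟩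
  rintro _ ⟨x, rfl⟩
  have h := trigPoly_eq_sum hs !₂[x.1, x.2]
  simp only [Matrix.cons_val_zero, Matrix.cons_val_one] at h
  refine (congrArg norm h).trans_le (norm_sum_le_of_le _ fun k _ => ?_)
  rw [norm_mul, mul_comm Complex.I, Complex.norm_exp_ofReal_mul_I, mul_one]

/-- Dyadic pieces of an annular partition sum up by telescoping. -/
theorem ContDiffBump.sum_dyadic_eq_one
    {V : Type*} [NormedAddCommGroup V] [InnerProductSpace ℝ V] [FiniteDimensional ℝ V]
    (χ : ContDiffBump (0 : V)) {n : ℕ} {ξ : V}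
    (hlow : χ.rOut ≤ 2 * ‖ξ‖) (hhigh : ‖ξ‖ ≤ χ.rIn * 2 ^ n) :
    ∑ j ∈ Finset.range (n + 1),
      (χ (((2 : ℝ) ^ j)⁻¹ • ξ) - χ ((2 : ℝ) • ((2 : ℝ) ^ j)⁻¹ • ξ)) = 1 := by
  have htel : ∀ N : ℕ, ∑ j ∈ Finset.range (N + 1),
      (χ (((2 : ℝ) ^ j)⁻¹ • ξ) - χ ((2 : ℝ) • ((2 : ℝ) ^ j)⁻¹ • ξ)) =
        χ (((2 : ℝ) ^ N)⁻¹ • ξ) - χ ((2 : ℝ) • ξ) := by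
    intro N
    induction N with
    | zero => simp
    | succ N ih =>
      have h : (2 : ℝ) • ((2 : ℝ) ^ (N + 1))⁻¹ • ξ = ((2 : ℝ) ^ N)⁻¹ • ξ := by
        rw [smul_smul]; congr 1; field_simp; ring
      rw [Finset.sum_range_succ, ih, h]; ring
  rw [htel, χ.zero_of_le_dist (x := (2 : ℝ) • ξ), χ.one_of_mem_closedBall, sub_zero]
  · rw [mem_closedBall_zero_iff, norm_smul, norm_inv, norm_pow, Real.norm_eq_abs, abs_two,
      inv_mul_le_iff₀ (by positivity)]
    linarith
  · rwa [dist_zero_right, norm_smul, Real.norm_eq_abs, abs_two]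

/-- Quantified `L^∞` bound for degree-zero homogeneous Fourier multipliers on
frequency-localized mean-free functions: if `m ∈ C^∞(ℝ² ∖ {0})` is homogeneous of degree `0`
and `T_m` is the associated Fourier multiplier, then there is `C_m ≥ 1` such that for every
`μ ≥ 10` and every mean-free trigonometric polynomial `a` with frequencies in
`{k : 0 < |k| ≤ μ}`, one has `‖T_m a‖_{L^∞(𝕋²)} ≤ C_m log(μ) ‖a‖_{L^∞(𝕋²)}`. -/
theorem multiplier_log_bound (m : ℝ × ℝ → ℂ)
    (hm_smooth : ContDiffOn ℝ (⊤ : ℕ∞) m {(0 : ℝ × ℝ)}ᶜ)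
    (hm_hom : ∀ (c : ℝ) (ξ : ℝ × ℝ), 0 < c → ξ ≠ 0 → m (c • ξ) = m ξ) :
    ∃ Cm : ℝ, 1 ≤ Cm ∧
      ∀ μ : ℝ, 10 ≤ μ →
        ∀ ahat : ℤ × ℤ → ℂ,
          (∀ k : ℤ × ℤ, k = 0 ∨ μ < znorm k → ahat k = 0) →
          (⨆ x : ℝ × ℝ, ‖trigPoly (fun k => m ((k.1 : ℝ), (k.2 : ℝ)) * ahat k) x‖) ≤
            Cm * Real.log μ * ⨆ x : ℝ × ℝ, ‖trigPoly ahat x‖ := by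
  let χ : ContDiffBump (0 : EuclideanSpace ℝ (Fin 2)) := ⟨1, 2, one_pos, one_lt_two⟩
  let toProd : EuclideanSpace ℝ (Fin 2) → ℝ × ℝ := fun ξ => (ξ 0, ξ 1)
  have hprod_ne {ξ : EuclideanSpace ℝ (Fin 2)} (hξ : ξ ≠ 0) : toProd ξ ≠ 0 := by
    contrapose! hξ
    ext i
    fin_cases i
    · exact congrArg Prod.fst hξ
    · exact congrArg Prod.snd hξ
  have hg (ξ : EuclideanSpace ℝ (Fin 2)) (hξ : ξ ≠ 0) :
      ContDiffAt ℝ (⊤ : ℕ∞) (fun ξ => m (toProd ξ)) ξ :=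
    ((hm_smooth _ (hprod_ne hξ)).contDiffAt (isOpen_compl_singleton.mem_nhds (hprod_ne hξ))).comp ξ
      (by fun_prop)
  let f : EuclideanSpace ℝ (Fin 2) → ℂ :=
    fun ξ => m (toProd ξ) * ((χ ξ - χ ((2 : ℝ) • ξ) : ℝ) : ℂ)
  have hsupp : HasCompactSupport f := by
    refine HasCompactSupport.of_support_subset_isCompact
      (isCompact_closedBall (0 : EuclideanSpace ℝ (Fin 2)) 2) fun ξ hξ => ?_
    by_contra! hn
    rw [mem_closedBall_zero_iff, not_le] at hn
    refine hξ ?_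
    have h1 : χ ξ = 0 := χ.zero_of_le_dist (by rw [dist_zero_right]; exact hn.le)
    have h2 : χ ((2 : ℝ) • ξ) = 0 := χ.zero_of_le_dist (by
      rw [dist_zero_right, norm_smul, Real.norm_eq_abs, abs_two]
      change 2 ≤ _
      linarith)
    simp [f, h1, h2]
  obtain ⟨C, hC0, hC⟩ :=
    exists_uniform_bound_of_hasCompactSupport (χ.contDiff_sub_dilate_mul hg) hsupp
  refine ⟨4 * C + 1, by linarith, fun μ hμ ahat ha => ?_⟩
  set s : Finset (ℤ × ℤ) := (finite_setOf_znorm_le μ).toFinset.erase 0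
  have hs_mem {k : ℤ × ℤ} : k ∈ s ↔ k ≠ 0 ∧ znorm k ≤ μ := by simp [s]
  have hs (k : ℤ × ℤ) (hk : k ∉ s) : ahat k = 0 := by
    refine ha k ?_
    rw [hs_mem] at hk
    by_contra! h
    exact hk h
  set B := ⨆ x : ℝ × ℝ, ‖trigPoly ahat x‖
  have hB (x : ℝ × ℝ) : ‖trigPoly ahat x‖ ≤ B := le_ciSup (bddAbove_range_norm_trigPoly hs) x
  have hB0 : 0 ≤ B := (norm_nonneg _).trans (hB 0)
  obtain ⟨n, hn⟩ : ∃ n : ℕ, n = ⌈Real.logb 2 μ⌉₊ := ⟨_, rfl⟩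
  have hμn : μ ≤ 2 ^ n := by
    have h : Real.logb 2 μ ≤ n := hn ▸ Nat.le_ceil _
    rwa [Real.logb_le_iff_le_rpow one_lt_two (by linarith), Real.rpow_natCast] at h
  have hlog2 : 0.5 ≤ Real.log 2 := by linarith [Real.log_two_gt_d9]
  have hlogμ : 2 ≤ Real.log μ := by
    have h8 : Real.log 8 = 3 * Real.log 2 := by
      rw [show (8 : ℝ) = 2 ^ 3 by norm_num, Real.log_pow]; norm_num
    have : Real.log 8 ≤ Real.log μ := Real.log_le_log (by norm_num) (by linarith)
    linarith [Real.log_two_gt_d9]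
  have hnlog : (n + 1 : ℝ) ≤ 4 * Real.log μ := by
    have h0 : 0 ≤ Real.logb 2 μ := Real.logb_nonneg one_lt_two (by linarith)
    have h1 : (n : ℝ) < Real.logb 2 μ + 1 := hn ▸ Nat.ceil_lt_add_one h0
    have h2 : Real.logb 2 μ ≤ 2 * Real.log μ := by
      rw [Real.logb, div_le_iff₀ (by linarith)]
      nlinarith
    linarith
  refine ciSup_le fun x => ?_
  have hdyadic (k : ℤ × ℤ) (hk : k ∈ s) : m ((k.1 : ℝ), (k.2 : ℝ)) =
      ∑ j ∈ Finset.range (n + 1), f (((2 : ℝ) ^ j)⁻¹ • freqVec k) := by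
    obtain ⟨hk0, hkμ⟩ := hs_mem.1 hk
    have h1 := one_le_znorm hk0
    have hne : ((k.1 : ℝ), (k.2 : ℝ)) ≠ 0 := fun h =>
      hk0 (Prod.ext (Int.cast_eq_zero.1 (congrArg Prod.fst h))
        (Int.cast_eq_zero.1 (congrArg Prod.snd h)))
    have hf (j : ℕ) : f (((2 : ℝ) ^ j)⁻¹ • freqVec k) = m ((k.1 : ℝ), (k.2 : ℝ)) *
        ((χ (((2 : ℝ) ^ j)⁻¹ • freqVec k) -
          χ ((2 : ℝ) • ((2 : ℝ) ^ j)⁻¹ • freqVec k) : ℝ) : ℂ) := by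
      rw [← hm_hom ((2 : ℝ) ^ j)⁻¹ _ (by positivity) hne]
      simp [f, toProd, freqVec]
    simp_rw [hf]
    rw [← Finset.mul_sum, ← Complex.ofReal_sum, χ.sum_dyadic_eq_one, Complex.ofReal_one, mul_one]
    · rw [norm_freqVec]; change 2 ≤ _; linarith
    · rw [norm_freqVec]; change _ ≤ 1 * _; linarith
  let y : EuclideanSpace ℝ (Fin 2) := !₂[x.1, x.2]
  have hsum : trigPoly (fun k => m ((k.1 : ℝ), (k.2 : ℝ)) * ahat k) x =
      ∑ j ∈ Finset.range (n + 1), ∑ k ∈ s, f (((2 : ℝ) ^ j)⁻¹ • freqVec k) * ahat k *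
        Complex.exp (Complex.I * (inner ℝ (freqVec k) y : ℝ)) := by
    refine (trigPoly_eq_sum (s := s) (fun k hk => by simp [hs k hk]) y).trans ?_
    rw [Finset.sum_comm]
    refine Finset.sum_congr rfl fun k hk => ?_
    rw [hdyadic k hk, Finset.sum_mul, Finset.sum_mul]
  have hle := norm_sum_le_of_le (Finset.range (n + 1)) fun j _ =>
    hC s freqVec ahat ((2 : ℝ) ^ j)⁻¹ B (fun z => trigPoly_eq_sum hs z ▸ hB _) y
  rw [hsum]
  refine hle.trans ?_
  rw [Finset.sum_const, Finset.card_range, nsmul_eq_mul]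
  push_cast
  calc (n + 1 : ℝ) * (C * B) ≤ 4 * Real.log μ * (C * B) :=
        mul_le_mul_of_nonneg_right hnlog (mul_nonneg hC0 hB0)
    _ ≤ (4 * C + 1) * Real.log μ * B := by nlinarith [mul_nonneg (by linarith : 0 ≤ Real.log μ) hB0]
end
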